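/- Let n, d be positive integers with either n ≥ 3 and d ≥ 4, or n = 2 and d ≥ 6. Let m_1, …, m_N be the non-constant monomials of degree at most d in the variables x_1, …, x_n (so N = C(n+d, n) − 1), and define v : ℝ^n → ℝ^N by v(ξ) = (m_1(ξ), …, m_N(ξ)). Then for every semialgebraic set S ⊆ ℝ^n with non-empty interior, the closed convex hull of v(S) in ℝ^N is not a spectrahedral shadow. -/

import Mathlib

/-- A set `K ⊆ ℝ^k` is a spectrahedral shadow if it is the feasible-region projection of a
symmetric linear matrix inequality. -/
def IsSpectrahedralShadow {k : ℕ} (K : Set (Fin k → ℝ)) : Prop :=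
  ∃ (d m : ℕ), 0 < d ∧ ∃ (A : Matrix (Fin d) (Fin d) ℝ)
    (B : Fin k → Matrix (Fin d) (Fin d) ℝ) (C : Fin m → Matrix (Fin d) (Fin d) ℝ),
    A.IsSymm ∧ (∀ i, (B i).IsSymm) ∧ (∀ j, (C j).IsSymm) ∧
    K = {ξ | ∃ η : Fin m → ℝ, (A + ∑ i, ξ i • B i + ∑ j, η j • C j).PosSemidef}

/-- A set `S ⊆ ℝ^n` is semialgebraic: a finite union of sets given by one polynomial
equation and finitely many strict polynomial inequalities. -/
def IsSemialgebraic {n : ℕ} (S : Set (Fin n → ℝ)) : Prop :=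
  ∃ (r : ℕ) (p : Fin r → MvPolynomial (Fin n) ℝ) (s : Fin r → ℕ)
    (q : (i : Fin r) → Fin (s i) → MvPolynomial (Fin n) ℝ),
    S = ⋃ i, {ξ | MvPolynomial.eval ξ (p i) = 0 ∧ ∀ j, 0 < MvPolynomial.eval ξ (q i j)}

theorem infinite_of_isTranscendenceBasis_real {k : Subfield ℝ} [Countable k] {ι : Type}
    {v : ι → ℝ}
    (hv : IsTranscendenceBasis k v) : Infinite ι := by
  by_contra hfin
  rw [not_infinite_iff_finite] at hfin
  have halg := hv.isAlgebraic
  have hcard : Cardinal.mk (Algebra.adjoin k (Set.range v)) ≤ Cardinal.aleph0 := by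
    rw [← Cardinal.mk_congr hv.1.aevalEquiv.toEquiv]
    exact MvPolynomial.cardinalMk_le_max.trans
      (max_le (max_le Cardinal.mk_le_aleph0 Cardinal.mk_le_aleph0) le_rfl)
  have hle := Algebra.IsAlgebraic.cardinalMk_le_max (Algebra.adjoin k (Set.range v)) ℝ
  rw [max_eq_right hcard, Cardinal.mk_real] at hle
  exact absurd hle (not_le.mpr Cardinal.aleph0_lt_continuum)

theorem countable_subfield_closure {s : Set ℝ} (hs : s.Countable) :
    Countable (Subfield.closure s) := by
  have := hs.to_subtype
  rw [← Cardinal.mk_le_aleph0_iff]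
  exact (Subfield.cardinalMk_closure_le_max s).trans (max_le Cardinal.mk_le_aleph0 le_rfl)

open scoped IntermediateField.algebraAdjoinAdjoin in
theorem formallySmooth_aeval_of_isTranscendenceBasis {k L ι : Type*} [Field k] [Field L]
    [CharZero k] [Algebra k L] {v : ι → L} (hv : IsTranscendenceBasis k v) :
    (MvPolynomial.aeval (R := k) v).toRingHom.FormallySmooth := by
  have hcomp : (MvPolynomial.aeval (R := k) v).toRingHom =
    (algebraMap (Algebra.adjoin k (Set.range v)) L).comp
      (hv.1.aevalEquiv.toRingEquiv : MvPolynomial ι k →+* Algebra.adjoin k (Set.range v)) := by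
    ext <;> simp
  have : Algebra.FormallySmooth (Algebra.adjoin k (Set.range v))
      (IntermediateField.adjoin k (Set.range v)) :=
    .of_isLocalization (nonZeroDivisors _)
  have := hv.isAlgebraic_field
  have : CharZero (IntermediateField.adjoin k (Set.range v)) :=
    charZero_of_injective_algebraMap (algebraMap k _).injective
  have : Algebra.FormallyEtale (IntermediateField.adjoin k (Set.range v)) L :=
    Algebra.FormallyEtale.of_isSeparable _ L
  have hsmooth : Algebra.FormallySmooth (Algebra.adjoin k (Set.range v)) L :=
    .comp _ (IntermediateField.adjoin k (Set.range v)) _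
  rw [hcomp]
  refine RingHom.FormallySmooth.comp ?_ ?_
  · exact RingHom.FormallySmooth.of_bijective hv.1.aevalEquiv.bijective
  · rw [RingHom.formallySmooth_algebraMap]
    exact hsmooth

/-- A Taylor expansion ring homomorphism: all reals are expanded as formal power series,
constants from a prescribed countable set stay fixed, and some algebraically independent reals
`t i` are sent to `t i + X i`. -/
theorem exists_taylor_ringHom (m : ℕ) {s : Set ℝ} (hs : s.Countable) :
    ∃ (t : Fin m → ℝ) (φ : ℝ →+* MvPowerSeries (Fin m) ℝ),
      (∀ a ∈ s, φ a = MvPowerSeries.C a) ∧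
      ∀ i, φ (t i) = MvPowerSeries.C (t i) + MvPowerSeries.X i := by
  classical
  have := countable_subfield_closure hs
  set k := Subfield.closure s
  obtain ⟨ι, v, hv⟩ := exists_isTranscendenceBasis' k ℝ
  have := infinite_of_isTranscendenceBasis_real hv
  let e : Fin m ↪ ι := Fin.valEmbedding.trans (Infinite.natEmbedding ι)
  let S := MvPowerSeries (Fin m) ℝ
  let I : Ideal S := .span (.range MvPowerSeries.X)
  let w : ι → S := fun j =>
    MvPowerSeries.C (v j) + ∑ i, if e i = j then MvPowerSeries.X i else 0
  let ψ : MvPolynomial ι k →+* S :=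
    MvPolynomial.eval₂Hom ((MvPowerSeries.C (σ := Fin m) (R := ℝ)).comp k.subtype) w
  let : Algebra (MvPolynomial ι k) ℝ := (MvPolynomial.aeval (R := k) v).toRingHom.toAlgebra
  let : Algebra (MvPolynomial ι k) S := ψ.toAlgebra
  have : Algebra.FormallySmooth (MvPolynomial ι k) ℝ :=
    formallySmooth_aeval_of_isTranscendenceBasis hv
  have hmk : (Ideal.Quotient.mk I).comp ψ =
      ((Ideal.Quotient.mk I).comp MvPowerSeries.C).comp
        (MvPolynomial.aeval (R := k) v).toRingHom := by
    refine MvPolynomial.ringHom_ext (fun a => ?_) (fun j => ?_)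
    · simp [ψ]
      rfl
    · simp only [ψ, w, RingHom.comp_apply, MvPolynomial.eval₂Hom_X', map_add,
        AlgHom.toRingHom_eq_coe, RingHom.coe_coe, MvPolynomial.aeval_X, add_eq_left]
      rw [Ideal.Quotient.eq_zero_iff_mem]
      refine Ideal.sum_mem _ fun i _ => ?_
      split_ifs
      · exact Ideal.subset_span ⟨i, rfl⟩
      · exact zero_mem _
  let f : ℝ →ₐ[MvPolynomial ι k] S ⧸ I :=
    { (Ideal.Quotient.mk I).comp MvPowerSeries.C with
      commutes' := fun p => (RingHom.congr_fun hmk p).symm }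
  obtain ⟨g, -⟩ := Algebra.FormallySmooth.exists_mkₐ_comp_eq_of_isAdicComplete (I := I) f
  refine ⟨v ∘ e, g.toRingHom, fun a ha => ?_, fun i => ?_⟩
  · have h : g ((MvPolynomial.aeval (R := k) v) (MvPolynomial.C ⟨a, Subfield.subset_closure ha⟩)) =
        ψ (MvPolynomial.C ⟨a, Subfield.subset_closure ha⟩) := g.commutes _
    rw [MvPolynomial.aeval_C, MvPolynomial.coe_eval₂Hom, MvPolynomial.eval₂_C] at h
    exact h
  · have h := g.commutes (MvPolynomial.X (e i))
    simpa [RingHom.algebraMap_toAlgebra, ψ, w] using h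

open MvPowerSeries in
/-- On a finite-dimensional space of power series, the coefficients of low degree bound all
coefficients of moderate degree. -/
theorem exists_coeff_bound {m : ℕ} (U : Submodule ℝ (MvPowerSeries (Fin m) ℝ))
    [FiniteDimensional ℝ U] (B : ℕ) :
    ∃ M ≥ B, ∃ K : ℝ, 0 ≤ K ∧ ∀ h ∈ U, ∃ α : Fin m →₀ ℕ, α.degree ≤ M ∧
      ∀ β : Fin m →₀ ℕ, β.degree ≤ 2 * M → |coeff β h| ≤ K * |coeff α h| := by
  classical
  let ker : ℕ → Submodule ℝ U := fun M =>
    ⨅ α ∈ {α : Fin m →₀ ℕ | α.degree ≤ M}, ((coeff (R := ℝ) α) ∘ₗ U.subtype).ker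
  have mem_ker : ∀ M h, h ∈ ker M ↔ ∀ α : Fin m →₀ ℕ, α.degree ≤ M →
      coeff α (h : MvPowerSeries (Fin m) ℝ) = 0 := by
    intro M h
    simp [ker, Submodule.mem_iInf]
  let kerHom : ℕ →o (Submodule ℝ U)ᵒᵈ :=
    ⟨fun M => OrderDual.toDual (ker M), fun M M' hM h hh =>
      (mem_ker M h).2 fun α hα => (mem_ker M' h).1 hh α (hα.trans hM)⟩
  obtain ⟨M₀, hM₀⟩ := IsArtinian.monotone_stabilizes kerHom
  have hker : ∀ h : U, (∀ α : Fin m →₀ ℕ, α.degree ≤ M₀ →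
      coeff α (h : MvPowerSeries (Fin m) ℝ) = 0) → h = 0 := by
    intro h hh
    ext α
    have : h ∈ ker (max M₀ α.degree) := by
      have heq : ker M₀ = ker (max M₀ α.degree) := hM₀ _ (le_max_left _ _)
      rw [← heq, mem_ker]
      exact hh
    exact (mem_ker _ _).1 this α (le_max_right _ _)
  set M := max M₀ B
  have := (Finsupp.finite_of_degree_le (σ := Fin m) M).fintype
  let T : U →ₗ[ℝ] ({α : Fin m →₀ ℕ | α.degree ≤ M} → ℝ) :=
    LinearMap.pi fun α => (coeff (R := ℝ) α.1) ∘ₗ U.subtype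
  have hT : LinearMap.ker T = ⊥ := by
    rw [LinearMap.ker_eq_bot']
    intro h hh
    exact hker h fun α hα => congrFun hh ⟨α, hα.trans (le_max_left _ _)⟩
  obtain ⟨r, hr⟩ := T.exists_leftInverse_of_injective hT
  let l : (Fin m →₀ ℕ) → ({α : Fin m →₀ ℕ | α.degree ≤ M} → ℝ) →ₗ[ℝ] ℝ :=
    fun β => (coeff (R := ℝ) β) ∘ₗ U.subtype ∘ₗ r
  let J := (Finsupp.finite_of_degree_le (σ := Fin m) (2 * M)).toFinset
  let K : (Fin m →₀ ℕ) → ℝ := fun β => ∑ α, |l β (Pi.single α 1)|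
  have hK : ∀ β, 0 ≤ K β := fun β => Finset.sum_nonneg fun _ _ => abs_nonneg _
  refine ⟨M, le_max_right _ _, ∑ β ∈ J, K β, Finset.sum_nonneg fun β _ => hK β, fun h hh => ?_⟩
  have hne : (Finset.univ : Finset {α : Fin m →₀ ℕ | α.degree ≤ M}).Nonempty :=
    ⟨⟨0, by simp⟩, Finset.mem_univ _⟩
  obtain ⟨α, -, hα⟩ := Finset.exists_max_image Finset.univ
    (fun α : {α : Fin m →₀ ℕ | α.degree ≤ M} => |coeff α.1 h|) hne
  refine ⟨α, α.2, fun β hβ => ?_⟩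
  have hcoeff : coeff β h = ∑ α, T ⟨h, hh⟩ α * l β (Pi.single α 1) := by
    have := LinearMap.pi_apply_eq_sum_univ (l β) (T ⟨h, hh⟩)
    have hr' : r (T ⟨h, hh⟩) = ⟨h, hh⟩ := LinearMap.congr_fun hr _
    simp only [l, LinearMap.comp_apply, hr', smul_eq_mul] at this
    simp only [l, LinearMap.comp_apply]
    refine this.trans (Finset.sum_congr rfl fun a _ => ?_)
    congr! 5
    simp [Pi.single_apply, eq_comm]
  calc |coeff β h| ≤ ∑ a, |T ⟨h, hh⟩ a * l β (Pi.single a 1)| := by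
        rw [hcoeff]; exact Finset.abs_sum_le_sum_abs _ _
    _ ≤ ∑ a, |l β (Pi.single a 1)| * |coeff α.1 h| := by
        refine Finset.sum_le_sum fun a _ => ?_
        rw [abs_mul, mul_comm]
        exact mul_le_mul_of_nonneg_left (hα a (Finset.mem_univ _)) (abs_nonneg _)
    _ = K β * |coeff α.1 h| := by rw [Finset.sum_mul]
    _ ≤ _ := by
        refine mul_le_mul_of_nonneg_right ?_ (abs_nonneg _)
        exact Finset.single_le_sum (f := K) (fun β _ => hK β) (by simpa [J] using hβ)

open MvPowerSeries in
/-- A weighted-coefficient functional which is nonnegative on the squares of a finite-dimensional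
space of power series, with prescribed growth rates `Ψ` on the (rescaled) monomials in `G`. -/
theorem exists_functional {m : ℕ} (Φ Ψ : (Fin m →₀ ℕ) → ℤ) (G : Set (Fin m →₀ ℕ))
    (hG : ∀ α, α + α ∈ G) (hdiag : ∀ α, Ψ (α + α) = 2 * Φ α)
    (hoff : ∀ α β, α ≠ β → α + β ∈ G → Ψ (α + β) < Φ α + Φ β)
    (U : Submodule ℝ (MvPowerSeries (Fin m) ℝ)) [FiniteDimensional ℝ U] (B : ℕ) :
    ∃ (c μ : ℝ) (L : MvPowerSeries (Fin m) ℝ →ₗ[ℝ] ℝ), 0 < c ∧ 1 < μ ∧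
      (∀ h ∈ U, 0 ≤ L (h * h)) ∧
      ∀ γ ∈ G, γ.degree ≤ B → L (monomial γ (c ^ γ.degree)) = μ ^ Ψ γ := by
  classical
  obtain ⟨M, hMB, K, hK, hcoef⟩ := exists_coeff_bound U B
  let J := (Finsupp.finite_of_degree_le (σ := Fin m) (2 * M)).toFinset
  have hJ : ∀ γ, γ ∈ J ↔ γ.degree ≤ 2 * M := fun γ => by simp [J]
  let P := J.sigma fun γ => Finset.HasAntidiagonal.antidiagonal γ
  let C : ℕ := 1 + ∑ α ∈ J, 2 * (Φ α).natAbs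
  have hC : ∀ α β : Fin m →₀ ℕ, α.degree ≤ M → M < β.degree → β.degree ≤ 2 * M →
      Φ β - C * β.degree + 1 ≤ Φ α - C * α.degree := by
    intro α β hα hMβ hβ
    have h1 : 2 * (Φ α).natAbs ≤ ∑ α ∈ J, 2 * (Φ α).natAbs :=
      Finset.single_le_sum (f := fun α => 2 * (Φ α).natAbs) (fun _ _ => Nat.zero_le _)
        ((hJ α).2 (by omega))
    have h2 : 2 * (Φ β).natAbs ≤ ∑ α ∈ J, 2 * (Φ α).natAbs :=
      Finset.single_le_sum (f := fun α => 2 * (Φ α).natAbs) (fun _ _ => Nat.zero_le _)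
        ((hJ β).2 hβ)
    have h3 : (C : ℤ) * (α.degree + 1) ≤ C * β.degree :=
      mul_le_mul_of_nonneg_left (by exact_mod_cast (by omega)) (by positivity)
    rw [mul_add, mul_one] at h3
    have h4 : C = 1 + ∑ α ∈ J, 2 * (Φ α).natAbs := rfl
    omega
  clear_value C
  obtain ⟨μ, hμ2, hμK, hμP⟩ : ∃ μ : ℝ, 2 ≤ μ ∧ K ≤ μ ∧ (P.card : ℝ) ≤ μ := by
    have : (0 : ℝ) ≤ P.card := by positivity
    exact ⟨K + P.card + 2, by linarith, by linarith, by linarith⟩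
  have hμ0 : 0 < μ := by linarith
  let w : (Fin m →₀ ℕ) → ℝ := fun γ => if γ ∈ G then μ ^ (Ψ γ - C * γ.degree) else 0
  let L : MvPowerSeries (Fin m) ℝ →ₗ[ℝ] ℝ := ∑ γ ∈ J, w γ • coeff γ
  have hL : ∀ h, L h = ∑ γ ∈ J, w γ * coeff γ h := fun h => by simp [L]
  refine ⟨μ ^ C, μ, L, by positivity, by linarith, fun h hh => ?_, fun γ hγ hdeg => ?_⟩
  · obtain ⟨α₁, hα₁, hbound⟩ := hcoef h hh
    let a : (Fin m →₀ ℕ) → ℝ := fun α => |coeff α h| * μ ^ (Φ α - C * α.degree)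
    have ha0 : ∀ α, 0 ≤ a α := fun α => by positivity
    obtain ⟨α₀, hα₀, hmax⟩ := Finset.exists_max_image
      (Finsupp.finite_of_degree_le (σ := Fin m) M).toFinset a ⟨0, by simp⟩
    simp only [Set.Finite.mem_toFinset, Set.mem_ofPred_eq] at hα₀ hmax
    have ha : ∀ β : Fin m →₀ ℕ, β.degree ≤ 2 * M → a β ≤ a α₀ := by
      intro β hβ
      rcases le_or_gt β.degree M with h | hMβ
      · exact hmax β h
      have hle : μ ^ (Φ β - C * β.degree) * μ ≤ μ ^ (Φ α₁ - C * α₁.degree) := by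
        rw [← zpow_add_one₀ hμ0.ne']
        exact zpow_le_zpow_right₀ (by linarith) (hC α₁ β hα₁ hMβ hβ)
      calc a β ≤ (K * |coeff α₁ h|) * μ ^ (Φ β - C * β.degree) :=
            mul_le_mul_of_nonneg_right (hbound β hβ) (by positivity)
        _ ≤ (μ * |coeff α₁ h|) * μ ^ (Φ β - C * β.degree) := by gcongr
        _ = |coeff α₁ h| * (μ ^ (Φ β - C * β.degree) * μ) := by ring
        _ ≤ a α₁ := mul_le_mul_of_nonneg_left hle (abs_nonneg _)
        _ ≤ a α₀ := hmax α₁ hα₁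
    let term : (Fin m →₀ ℕ) × (Fin m →₀ ℕ) → ℝ :=
      fun p => w (p.1 + p.2) * (coeff p.1 h * coeff p.2 h)
    have hsum : L (h * h) = ∑ p ∈ P, term p.2 := by
      rw [hL, Finset.sum_sigma]
      refine Finset.sum_congr rfl fun γ _ => ?_
      rw [coeff_mul, Finset.mul_sum]
      refine Finset.sum_congr rfl fun p hp => ?_
      rw [Finset.HasAntidiagonal.mem_antidiagonal] at hp
      simp [term, hp]
    have hdiag_term : ∀ α, term (α, α) = a α ^ 2 := by
      intro α
      have hexp : Ψ (α + α) - C * ((α + α).degree : ℕ) =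
          (Φ α - C * α.degree) + (Φ α - C * α.degree) := by
        rw [hdiag, map_add]; push_cast; ring
      simp only [term, w, if_pos (hG α), hexp, zpow_add₀ hμ0.ne', a, mul_pow, sq_abs]
      ring
    have hoff_term : ∀ α β, α ≠ β → (α + β).degree ≤ 2 * M →
        |term (α, β)| ≤ a α₀ ^ 2 * μ⁻¹ := by
      intro α β hne hdeg
      by_cases hmem : α + β ∈ G
      · rw [map_add] at hdeg
        have hle : μ ^ (Ψ (α + β) - C * ((α + β).degree : ℕ)) ≤
            μ ^ (Φ α - C * α.degree) * μ ^ (Φ β - C * β.degree) * μ⁻¹ := by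
          rw [← zpow_add₀ hμ0.ne', ← zpow_sub_one₀ hμ0.ne']
          refine zpow_le_zpow_right₀ (by linarith) ?_
          have := hoff α β hne hmem
          rw [map_add]; push_cast
          linarith
        have hα : a α ≤ a α₀ := ha α (by omega)
        have hβ : a β ≤ a α₀ := ha β (by omega)
        calc |term (α, β)|
            = μ ^ (Ψ (α + β) - C * ((α + β).degree : ℕ)) * (|coeff α h| * |coeff β h|) := by
              simp only [term, w, if_pos hmem, abs_mul, abs_of_pos (zpow_pos hμ0 _)]
          _ ≤ (μ ^ (Φ α - C * α.degree) * μ ^ (Φ β - C * β.degree) * μ⁻¹) *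
                (|coeff α h| * |coeff β h|) :=
              mul_le_mul_of_nonneg_right hle (by positivity)
          _ = (a α * a β) * μ⁻¹ := by simp only [a]; ring
          _ ≤ (a α₀ * a α₀) * μ⁻¹ := by
              refine mul_le_mul_of_nonneg_right ?_ (by positivity)
              exact mul_le_mul hα hβ (ha0 _) (ha0 _)
          _ = _ := by ring
      · simp only [term, w, if_neg hmem, zero_mul, abs_zero]
        positivity
    let p₀ : (_ : Fin m →₀ ℕ) × ((Fin m →₀ ℕ) × (Fin m →₀ ℕ)) := ⟨α₀ + α₀, α₀, α₀⟩
    have hp₀ : p₀ ∈ P := by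
      simp only [P, p₀, Finset.mem_sigma, Finset.HasAntidiagonal.mem_antidiagonal, hJ, map_add,
        and_true]
      omega
    have hlower : ∀ p ∈ P.erase p₀, -(a α₀ ^ 2 * μ⁻¹) ≤ term p.2 := by
      rintro ⟨γ, α, β⟩ hp
      have hp := Finset.mem_of_mem_erase hp
      simp only [P, Finset.mem_sigma, Finset.HasAntidiagonal.mem_antidiagonal, hJ] at hp
      obtain ⟨hdeg, rfl⟩ := hp
      by_cases hαβ : α = β
      · subst hαβ
        rw [hdiag_term]
        have : 0 ≤ a α₀ ^ 2 * μ⁻¹ := by positivity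
        have : 0 ≤ a α ^ 2 := by positivity
        linarith
      · exact (abs_le.1 (hoff_term α β hαβ hdeg)).1
    rw [hsum, ← Finset.add_sum_erase P _ hp₀]
    have hrest := Finset.card_nsmul_le_sum (P.erase p₀) (fun p => term p.2) _ hlower
    have hcard : ((P.erase p₀).card : ℝ) ≤ μ :=
      (Nat.cast_le.2 (Finset.card_le_card (Finset.erase_subset _ _))).trans hμP
    have hbd : ((P.erase p₀).card : ℝ) * (a α₀ ^ 2 * μ⁻¹) ≤ a α₀ ^ 2 := by
      calc _ ≤ μ * (a α₀ ^ 2 * μ⁻¹) := by gcongr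
        _ = _ := by field_simp
    rw [nsmul_eq_mul, mul_neg] at hrest
    have hd : term p₀.2 = a α₀ ^ 2 := hdiag_term α₀
    linarith
  · have hγJ : γ ∈ J := (hJ γ).2 (by omega)
    rw [hL, Finset.sum_eq_single γ]
    · simp only [w, if_pos hγ, coeff_monomial_same]
      rw [← pow_mul, ← zpow_natCast, ← zpow_add₀ hμ0.ne']
      congr 1
      push_cast; ring
    · intro β _ hβ
      rw [coeff_monomial_ne hβ, mul_zero]
    · exact fun h => absurd hγJ h

/-- A real polynomial `f` is not a sum of squares in a robust local sense: on any
finite-dimensional space `U` of power series there is a normalized functional, nonnegative on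
squares from `U`, which is negative on some dilation of `f`. -/
def LocallySeparatedFromSquares {m : ℕ} (f : MvPolynomial (Fin m) ℝ) : Prop :=
  ∀ U : Submodule ℝ (MvPowerSeries (Fin m) ℝ), FiniteDimensional ℝ U →
    ∃ (c : ℝ) (L : MvPowerSeries (Fin m) ℝ →ₗ[ℝ] ℝ), 0 < c ∧ L 1 = 1 ∧
      (∀ h ∈ U, 0 ≤ L (h * h)) ∧
      L (MvPolynomial.aeval (fun i => c • MvPowerSeries.X i) f) < 0

theorem totalDegree_aeval_le {σ τ : Type*} {g : σ → MvPolynomial τ ℝ}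
    (hg : ∀ i, (g i).totalDegree ≤ 1) (f : MvPolynomial σ ℝ) :
    (MvPolynomial.aeval g f).totalDegree ≤ f.totalDegree := by
  rw [MvPolynomial.aeval_def, MvPolynomial.eval₂_eq]
  refine MvPolynomial.totalDegree_finsetSum_le fun γ hγ => ?_
  refine (MvPolynomial.totalDegree_mul _ _).trans ?_
  rw [MvPolynomial.algebraMap_eq, MvPolynomial.totalDegree_C, zero_add]
  refine (MvPolynomial.totalDegree_finsetProd _ _).trans ?_
  refine le_trans (Finset.sum_le_sum fun i _ => ?_) (MvPolynomial.le_totalDegree hγ)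
  exact (MvPolynomial.totalDegree_pow _ _).trans
    ((Nat.mul_le_mul_left _ (hg i)).trans (mul_one _).le)

/-- A polynomial of degree at most `d` is an affine-linear combination of the nonconstant
monomials of degree at most `d`. -/
theorem exists_affine_of_totalDegree_le {n d N : ℕ} {mono : Fin N → (Fin n →₀ ℕ)}
    (hinj : Function.Injective mono)
    (hrange : Set.range mono = {α : Fin n →₀ ℕ | α ≠ 0 ∧ ∑ i, α i ≤ d})
    (F : MvPolynomial (Fin n) ℝ) (hF : F.totalDegree ≤ d) :
    ∃ (a : ℝ) (b : Fin N → ℝ),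
      F = MvPolynomial.C a + ∑ j, MvPolynomial.C (b j) * ∏ i, MvPolynomial.X i ^ mono j i := by
  classical
  have hmon : ∀ α : Fin n →₀ ℕ, ∏ i, (MvPolynomial.X i : MvPolynomial (Fin n) ℝ) ^ α i =
      MvPolynomial.monomial α 1 := fun α => by
    rw [MvPolynomial.monomial_eq, Finsupp.prod_fintype _ _ (by simp)]; simp
  refine ⟨F.coeff 0, fun j => F.coeff (mono j), ?_⟩
  ext α
  simp only [hmon, MvPolynomial.C_mul_monomial, mul_one, MvPolynomial.coeff_add,
    MvPolynomial.coeff_C, MvPolynomial.coeff_sum, MvPolynomial.coeff_monomial]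
  by_cases h0 : α = 0
  · subst h0
    rw [if_pos rfl, Finset.sum_eq_zero, add_zero]
    intro j _
    have : mono j ∈ {α : Fin n →₀ ℕ | α ≠ 0 ∧ ∑ i, α i ≤ d} := hrange ▸ ⟨j, rfl⟩
    rw [if_neg this.1]
  rw [if_neg (Ne.symm h0), zero_add]
  by_cases hα : ∑ i, α i ≤ d
  · obtain ⟨j, rfl⟩ : α ∈ Set.range mono := by rw [hrange]; exact ⟨h0, hα⟩
    rw [Finset.sum_eq_single j]
    · simp
    · intro j' _ hj'
      rw [if_neg (fun h => hj' (hinj h))]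
    · simp
  · rw [Finset.sum_eq_zero, MvPolynomial.coeff_eq_zero_of_totalDegree_lt]
    · rw [← Finsupp.degree_eq_sum] at hα
      exact lt_of_le_of_lt hF (not_le.1 hα)
    · intro j _
      refine if_neg ?_
      rintro rfl
      have : mono j ∈ {α : Fin n →₀ ℕ | α ≠ 0 ∧ ∑ i, α i ≤ d} := hrange ▸ ⟨j, rfl⟩
      exact hα this.2

/-- An affine function nonnegative on a set is nonnegative on its closed convex hull. -/
theorem affine_nonneg_of_mem_closure_convexHull {N : ℕ} {M : Set (Fin N → ℝ)} {a : ℝ}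
    {b : Fin N → ℝ} (h : ∀ ξ ∈ M, 0 ≤ a + ∑ j, b j * ξ j) {ξ : Fin N → ℝ}
    (hξ : ξ ∈ closure (convexHull ℝ M)) : 0 ≤ a + ∑ j, b j * ξ j := by
  let H : Set (Fin N → ℝ) := {ξ | 0 ≤ a + ∑ j, b j * ξ j}
  have hclosed : IsClosed H := isClosed_le (by fun_prop) (by fun_prop)
  have hconv : Convex ℝ H := by
    intro x hx y hy s t hs ht hst
    simp only [H, Set.mem_ofPred_eq, Pi.add_apply, Pi.smul_apply, smul_eq_mul] at *
    have heq : a + ∑ j, b j * (s * x j + t * y j) =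
        s * (a + ∑ j, b j * x j) + t * (a + ∑ j, b j * y j) := by
      simp only [mul_add, Finset.sum_add_distrib, Finset.mul_sum]
      simp only [mul_left_comm (b _)]
      linear_combination (-a) * hst
    rw [heq]
    positivity
  exact closure_minimal (convexHull_min h hconv) hclosed hξ

open scoped MatrixOrder in
theorem Matrix.PosSemidef.exists_eq_transpose_mul_self {ι : Type*} [Fintype ι]
    {M : Matrix ι ι ℝ} (hM : M.PosSemidef) : ∃ Y : Matrix ι ι ℝ, M = Y.transpose * Y := by
  classical
  obtain ⟨Y, hY⟩ := CStarAlgebra.nonneg_iff_eq_star_mul_self.mp hM.nonneg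
  exact ⟨Y, by rw [hY, Matrix.star_eq_conjTranspose, Matrix.conjTranspose_eq_transpose_of_trivial]⟩

theorem not_isSpectrahedralShadow_of_locallySeparated {n d m N : ℕ} {e : Fin m → Fin n}
    (he : Function.Injective e) {f : MvPolynomial (Fin m) ℝ} (hdeg : f.totalDegree ≤ d)
    (hf : ∀ y, 0 ≤ MvPolynomial.eval y f) (hsep : LocallySeparatedFromSquares f)
    {mono : Fin N → (Fin n →₀ ℕ)} (hinj : Function.Injective mono)
    (hrange : Set.range mono = {α : Fin n →₀ ℕ | α ≠ 0 ∧ ∑ i, α i ≤ d})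
    {S : Set (Fin n → ℝ)} (hint : (interior S).Nonempty) :
    ¬ IsSpectrahedralShadow
      (closure (convexHull ℝ ((fun (ξ : Fin n → ℝ) j => ∏ i, ξ i ^ mono j i) '' S))) := by
  classical
  set v : (Fin n → ℝ) → (Fin N → ℝ) := fun ξ j => ∏ i, ξ i ^ mono j i
  rintro ⟨D, l, -, A, B, Γ, -, -, -, hK⟩
  obtain ⟨p, hp⟩ := hint
  let s : Set ℝ := Set.range p ∪ (Set.range fun ab : Fin D × Fin D => A ab.1 ab.2) ∪
    (Set.range fun q : Fin N × Fin D × Fin D => B q.1 q.2.1 q.2.2) ∪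
    Set.range fun q : Fin l × Fin D × Fin D => Γ q.1 q.2.1 q.2.2
  have hs : s.Countable := Set.Finite.countable <|
    (((Set.finite_range _).union (Set.finite_range _)).union (Set.finite_range _)).union
      (Set.finite_range _)
  obtain ⟨t, φ, hφs, hφt⟩ := exists_taylor_ringHom m hs
  have hφp : ∀ i, φ (p i) = MvPowerSeries.C (p i) := fun i =>
    hφs _ (Or.inl (Or.inl (Or.inl ⟨i, rfl⟩)))
  have hφA : ∀ a b, φ (A a b) = MvPowerSeries.C (A a b) := fun a b =>
    hφs _ (Or.inl (Or.inl (Or.inr ⟨(a, b), rfl⟩)))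
  have hφB : ∀ i a b, φ (B i a b) = MvPowerSeries.C (B i a b) := fun i a b =>
    hφs _ (Or.inl (Or.inr ⟨(i, a, b), rfl⟩))
  have hφΓ : ∀ j a b, φ (Γ j a b) = MvPowerSeries.C (Γ j a b) := fun j a b =>
    hφs _ (Or.inr ⟨(j, a, b), rfl⟩)
  let T : Fin n → ℝ := Function.extend e t 0
  obtain ⟨k, hk⟩ : ∃ k : ℕ, p + (1 / ((k : ℝ) + 1)) • T ∈ S := by
    have hlim : Filter.Tendsto (fun k : ℕ => p + (1 / ((k : ℝ) + 1)) • T) Filter.atTop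
        (nhds (p + (0 : ℝ) • T)) :=
      tendsto_const_nhds.add (tendsto_one_div_add_atTop_nhds_zero_nat.smul_const T)
    rw [zero_smul, add_zero] at hlim
    exact (hlim.eventually (mem_interior_iff_mem_nhds.1 hp)).exists
  set r : ℝ := 1 / ((k : ℝ) + 1) with hr
  have hr0 : 0 < r := by positivity
  have hφr : φ r = MvPowerSeries.C r := by
    have h : (k + 1 : MvPowerSeries (Fin m) ℝ) * φ r = 1 := by
      rw [← map_natCast φ k, ← map_one φ, ← map_add, ← map_mul, hr]
      congr 1
      field_simp
    have h' : (k + 1 : MvPowerSeries (Fin m) ℝ) * MvPowerSeries.C r = 1 := by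
      rw [← map_natCast MvPowerSeries.C k, ← map_one MvPowerSeries.C, ← map_add, ← map_mul, hr]
      congr 1
      field_simp
    calc φ r = φ r * ((k + 1 : MvPowerSeries (Fin m) ℝ) * MvPowerSeries.C r) := by
          rw [h', mul_one]
      _ = ((k + 1 : MvPowerSeries (Fin m) ℝ) * φ r) * MvPowerSeries.C r := by ring
      _ = MvPowerSeries.C r := by rw [h, one_mul]
  set x : Fin n → ℝ := p + r • T
  have hφx : ∀ j, φ (x (e j)) = MvPowerSeries.C (x (e j)) + r • MvPowerSeries.X j := by
    intro j
    simp only [x, T, Pi.add_apply, Pi.smul_apply, he.extend_apply, smul_eq_mul, map_add, map_mul,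
      hφp, hφr, hφt, MvPowerSeries.smul_eq_C_mul]
    ring
  have hvK : v x ∈ closure (convexHull ℝ (v '' S)) :=
    subset_closure (subset_convexHull ℝ _ ⟨x, hk, rfl⟩)
  rw [hK] at hvK
  obtain ⟨η, hη⟩ := hvK
  obtain ⟨Y, hY⟩ := hη.exists_eq_transpose_mul_self
  have hlift : ∀ a b, MvPowerSeries.C (A a b) + ∑ i, B i a b • φ (v x i) +
      ∑ j, Γ j a b • φ (η j) = ∑ c, φ (Y c a) * φ (Y c b) := by
    intro a b
    have h := congrArg φ (congrFun (congrFun hY a) b)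
    simpa [Matrix.add_apply, Matrix.sum_apply, Matrix.mul_apply, hφA, hφB, hφΓ,
      MvPowerSeries.smul_eq_C_mul, mul_comm] using h
  let U : Submodule ℝ (MvPowerSeries (Fin m) ℝ) :=
    Submodule.span ℝ (Set.range fun q : Fin D × Fin D => φ (Y q.1 q.2))
  obtain ⟨c, L, hc, hL1, hLU, hLf⟩ := hsep U
    (FiniteDimensional.span_of_finite ℝ (Set.finite_range _))
  have hLC : ∀ a, L (MvPowerSeries.C a) = a := fun a => by
    rw [← mul_one (MvPowerSeries.C a), ← MvPowerSeries.smul_eq_C_mul, map_smul, hL1, smul_eq_mul,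
      mul_one]
  let ξ : Fin N → ℝ := fun i => L (φ (v x i))
  have hξ : ξ ∈ closure (convexHull ℝ (v '' S)) := by
    rw [hK]
    refine ⟨fun j => L (φ (η j)), ?_⟩
    set Z := A + ∑ i, ξ i • B i + ∑ j, L (φ (η j)) • Γ j with hZ
    have hentry : ∀ a b, Z a b = ∑ c, L (φ (Y c a) * φ (Y c b)) := by
      intro a b
      rw [← map_sum, ← hlift, map_add, map_add, hLC, map_sum, map_sum, hZ]
      simp [Matrix.add_apply, Matrix.sum_apply, ξ, mul_comm]
    refine Matrix.PosSemidef.of_dotProduct_mulVec_nonneg ?_ fun u => ?_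
    · ext a b
      simp only [Matrix.conjTranspose_apply, star_trivial, hentry, mul_comm]
    · have hsq : star u ⬝ᵥ (Z.mulVec u) =
          ∑ c, L ((∑ a, u a • φ (Y c a)) * ∑ b, u b • φ (Y c b)) := by
        simp only [dotProduct, Matrix.mulVec, star_trivial, hentry, Finset.sum_mul_sum, map_sum,
          smul_mul_smul_comm, map_smul, smul_eq_mul]
        simp only [Finset.mul_sum, Finset.sum_mul]
        rw [Finset.sum_comm_cycle]
        refine Finset.sum_congr rfl fun c _ => Finset.sum_congr rfl fun a _ =>
          Finset.sum_congr rfl fun b _ => ?_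
        ring
      rw [hsq]
      refine Finset.sum_nonneg fun c _ => hLU _ ?_
      exact Submodule.sum_mem _ fun a _ =>
        Submodule.smul_mem _ _ (Submodule.subset_span ⟨(c, a), rfl⟩)
  let g : Fin m → MvPolynomial (Fin n) ℝ := fun j =>
    MvPolynomial.C (c / r) * (MvPolynomial.X (e j) - MvPolynomial.C (x (e j)))
  have hg : ∀ j, (g j).totalDegree ≤ 1 := by
    intro j
    refine (MvPolynomial.totalDegree_mul _ _).trans ?_
    rw [MvPolynomial.totalDegree_C, zero_add]
    refine (MvPolynomial.totalDegree_sub _ _).trans ?_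
    simp
  obtain ⟨a, b, hab⟩ := exists_affine_of_totalDegree_le hinj hrange (MvPolynomial.aeval g f)
    ((totalDegree_aeval_le hg f).trans hdeg)
  have hnonneg : ∀ ζ ∈ v '' S, 0 ≤ a + ∑ j, b j * ζ j := by
    rintro _ ⟨z, -, rfl⟩
    have h : MvPolynomial.eval z (MvPolynomial.aeval g f) = a + ∑ j, b j * v z j := by
      rw [hab]; simp [v]
    rw [← h, ← MvPolynomial.coe_aeval_eq_eval, RingHom.coe_coe, ← AlgHom.comp_apply,
      MvPolynomial.comp_aeval]
    exact hf _
  have hpos := affine_nonneg_of_mem_closure_convexHull hnonneg hξ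
  have heval : MvPolynomial.aeval (fun i => φ (x i)) (MvPolynomial.aeval g f) =
      MvPolynomial.aeval (fun i => c • MvPowerSeries.X i) f := by
    rw [← AlgHom.comp_apply, MvPolynomial.comp_aeval]
    congr 2
    ext1 j
    simp only [g, map_mul, map_sub, MvPolynomial.aeval_X, MvPolynomial.aeval_C, hφx]
    have : c / r * r = c := by field_simp
    simp [MvPowerSeries.algebraMap_apply, MvPowerSeries.smul_eq_C_mul, ← mul_assoc, ← map_mul, this]
  rw [← heval, hab] at hLf
  have : L (MvPolynomial.aeval (fun i => φ (x i)) (MvPolynomial.C a +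
      ∑ j, MvPolynomial.C (b j) * ∏ i, MvPolynomial.X i ^ mono j i)) = a + ∑ j, b j * ξ j := by
    simp [MvPowerSeries.algebraMap_apply, hLC, ← MvPowerSeries.smul_eq_C_mul, ξ, v, map_prod]
  linarith

theorem aeval_smul_X_monomial {m : ℕ} (c : ℝ) (γ : Fin m →₀ ℕ) :
    MvPolynomial.aeval (fun i => c • (MvPowerSeries.X i : MvPowerSeries (Fin m) ℝ))
      (MvPolynomial.monomial γ (1 : ℝ)) = MvPowerSeries.monomial γ (c ^ γ.degree) := by
  have h : (MvPowerSeries.monomial γ (1 : ℝ)) =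
      ∏ i, (MvPowerSeries.X i : MvPowerSeries (Fin m) ℝ) ^ γ i := by
    have := congrArg MvPolynomial.coeToMvPowerSeries.ringHom
      (MvPolynomial.monomial_eq (s := γ) (a := (1 : ℝ)))
    rw [Finsupp.prod_fintype _ _ (by simp)] at this
    simpa only [map_prod, map_pow, map_mul, map_one, one_mul,
      MvPolynomial.coeToMvPowerSeries.ringHom_apply, MvPolynomial.coe_monomial,
      MvPolynomial.coe_X] using this
  rw [MvPolynomial.aeval_monomial, Finsupp.prod_fintype _ _ (by simp), map_one, one_mul]
  simp_rw [smul_pow, Finset.prod_smul, Finset.prod_pow_eq_pow_sum, ← Finsupp.degree_eq_sum, ← h,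
    ← map_smul, smul_eq_mul, mul_one]

/-- A simplicial agiform whose lattice points can be separated by a strictly midconvex height
function is locally separated from squares. -/
theorem locallySeparatedFromSquares_of_height {m : ℕ} (Φ Ψ : (Fin m →₀ ℕ) → ℤ)
    (G : Set (Fin m →₀ ℕ)) (hG : ∀ α, α + α ∈ G) (hdiag : ∀ α, Ψ (α + α) = 2 * Φ α)
    (hoff : ∀ α β, α ≠ β → α + β ∈ G → Ψ (α + β) < Φ α + Φ β)
    {k : ℕ} (hk : 0 < k) (w : Fin k → (Fin m →₀ ℕ)) {V : ℤ} (hV : ∀ i, Φ (w i) = V)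
    {γ : Fin m →₀ ℕ} (hγ : γ ∈ G) (hγV : 2 * V < Ψ γ) :
    LocallySeparatedFromSquares (∑ i, MvPolynomial.monomial (w i + w i) 1 -
      (k : ℝ) • MvPolynomial.monomial γ 1) := by
  intro U hU
  obtain ⟨c, μ, L, hc, hμ, hLU, hL⟩ := exists_functional Φ Ψ G hG hdiag hoff U
    (γ.degree + ∑ i, (w i + w i).degree)
  have h1 : L 1 = μ ^ Ψ 0 := by
    have := hL 0 (by simpa using hG 0) (by simp)
    rwa [map_zero, pow_zero, MvPowerSeries.monomial_zero_one] at this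
  have hpos : 0 < L 1 := h1 ▸ by positivity
  refine ⟨c, (L 1)⁻¹ • L, hc, ?_, fun h hh => ?_, ?_⟩
  · simp [hpos.ne']
  · exact mul_nonneg (inv_nonneg.2 hpos.le) (hLU h hh)
  · refine mul_neg_of_pos_of_neg (inv_pos.2 hpos) ?_
    simp only [map_sub, map_sum, map_smul, aeval_smul_X_monomial]
    rw [hL γ hγ (by omega), Finset.sum_congr rfl (g := fun _ => μ ^ (2 * V))]
    · rw [Finset.sum_const, Finset.card_univ, Fintype.card_fin, nsmul_eq_mul, smul_eq_mul, ← mul_sub]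
      refine mul_neg_of_pos_of_neg (by exact_mod_cast hk) (sub_neg.2 ?_)
      exact zpow_lt_zpow_right₀ hμ hγV
    · intro i hi
      rw [hL _ (hG _), hdiag, hV]
      have := Finset.single_le_sum (f := fun i => (w i + w i).degree)
        (fun _ _ => Nat.zero_le _) hi
      omega

theorem totalDegree_agiform_le {m k D : ℕ} {w : Fin k → (Fin m →₀ ℕ)} {γ : Fin m →₀ ℕ}
    (hw : ∀ i, (w i + w i).degree ≤ D) (hγ : γ.degree ≤ D) :
    (∑ i, MvPolynomial.monomial (w i + w i) (1 : ℝ) -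
      (k : ℝ) • MvPolynomial.monomial γ 1).totalDegree ≤ D := by
  have key : ∀ α : Fin m →₀ ℕ, (MvPolynomial.monomial α (1 : ℝ)).totalDegree ≤ α.degree :=
    fun α => (MvPolynomial.totalDegree_monomial α one_ne_zero).le
  refine (MvPolynomial.totalDegree_sub _ _).trans (max_le ?_ ?_)
  · exact MvPolynomial.totalDegree_finsetSum_le fun i _ => (key _).trans (hw i)
  · exact (MvPolynomial.totalDegree_smul_le _ _).trans ((key _).trans hγ)

/-- The integer height function separating the Motzkin polynomial from squares. -/
def motzkinHeight (a b : ℤ) : ℤ :=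
  8 * ((a - 1) ^ 2 + (b - 1) ^ 2 - (a - 1) * (b - 1)) -
    (if a = 0 ∧ b = 0 ∨ a = 2 ∧ b = 1 ∨ a = 1 ∧ b = 2 then 4 else 0) +
    (if a = 1 ∧ b = 1 then 5 else 0)

theorem motzkinHeight_midpoint_lt {a b a' b' c d : ℕ} (hne : ¬ (a = a' ∧ b = b'))
    (hc : a + a' = c + c) (hd : b + b' = d + d) :
    2 * motzkinHeight c d < motzkinHeight a b + motzkinHeight a' b' := by
  by_cases h : c = 1 ∧ d = 1
  · obtain ⟨rfl, rfl⟩ := h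
    have ha : a ≤ 2 := by omega
    have hb : b ≤ 2 := by omega
    obtain rfl : a' = 2 - a := by omega
    obtain rfl : b' = 2 - b := by omega
    clear hc hd
    interval_cases a <;> interval_cases b <;> first | (exact absurd ⟨rfl, rfl⟩ hne) | decide
  · obtain ⟨x, hx⟩ : ∃ x : ℤ, (a : ℤ) = c + x := ⟨a - c, by ring⟩
    obtain ⟨y, hy⟩ : ∃ y : ℤ, (b : ℤ) = d + y := ⟨b - d, by ring⟩
    have hx' : (a' : ℤ) = c - x := by omega
    have hy' : (b' : ℤ) = d - y := by omega
    have hpos : 0 < x ^ 2 + y ^ 2 - x * y := by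
      have : x ≠ 0 ∨ y ≠ 0 := by omega
      rcases this with h | h
      · nlinarith [sq_nonneg (2 * y - x), sq_pos_of_ne_zero h]
      · nlinarith [sq_nonneg (2 * x - y), sq_pos_of_ne_zero h]
    have hcd : ¬ ((c : ℤ) = 1 ∧ (d : ℤ) = 1) := by omega
    simp only [motzkinHeight, hx, hy, hx', hy', if_neg hcd]
    split_ifs <;> linarith

/-- The integer height function separating the Choi-Lam polynomial from squares. -/
def choiLamHeight (a b c : ℤ) : ℤ :=
  (2 * a - 1) ^ 2 + (2 * b - 1) ^ 2 + (2 * c - 1) ^ 2 -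
    (if a = 0 ∧ b = 0 ∧ c = 0 ∨ a = 1 ∧ b = 1 ∧ c = 0 ∨ a = 0 ∧ b = 1 ∧ c = 1 ∨
      a = 1 ∧ b = 0 ∧ c = 1 then 2 else 0)

theorem choiLamHeight_midpoint_lt {a b c a' b' c' p q r : ℕ}
    (hne : ¬ (a = a' ∧ b = b' ∧ c = c'))
    (hp : a + a' = p + p) (hq : b + b' = q + q) (hr : c + c' = r + r) :
    2 * choiLamHeight p q r < choiLamHeight a b c + choiLamHeight a' b' c' := by
  obtain ⟨x, hx⟩ : ∃ x : ℤ, (a : ℤ) = p + x := ⟨a - p, by ring⟩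
  obtain ⟨y, hy⟩ : ∃ y : ℤ, (b : ℤ) = q + y := ⟨b - q, by ring⟩
  obtain ⟨z, hz⟩ : ∃ z : ℤ, (c : ℤ) = r + z := ⟨c - r, by ring⟩
  have hx' : (a' : ℤ) = p - x := by omega
  have hy' : (b' : ℤ) = q - y := by omega
  have hz' : (c' : ℤ) = r - z := by omega
  have hpos : 0 < x ^ 2 + y ^ 2 + z ^ 2 := by
    have : x ≠ 0 ∨ y ≠ 0 ∨ z ≠ 0 := by omega
    rcases this with h | h | h <;> positivity
  simp only [choiLamHeight, hx, hy, hz, hx', hy', hz']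
  split_ifs <;> linarith

theorem choiLamHeight_add_gt {a b c a' b' c' : ℕ}
    (ha : a + a' = 1) (hb : b + b' = 1) (hc : c + c' = 1) :
    3 < choiLamHeight a b c + choiLamHeight a' b' c' := by
  obtain rfl : a' = 1 - a := by omega
  obtain rfl : b' = 1 - b := by omega
  obtain rfl : c' = 1 - c := by omega
  have ha : a ≤ 1 := by omega
  have hb : b ≤ 1 := by omega
  have hc : c ≤ 1 := by omega
  interval_cases a <;> interval_cases b <;> interval_cases c <;> decide

/-- The exponents whose doubles are the vertices of the Newton polytope of the Motzkin
polynomial. -/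
noncomputable def motzkinVertex : Fin 3 → (Fin 2 →₀ ℕ) := fun i =>
  Finsupp.equivFunOnFinite.symm (![![0, 0], ![2, 1], ![1, 2]] i)

/-- The Motzkin polynomial `1 + x⁴y² + x²y⁴ - 3x²y²`. -/
noncomputable def motzkin : MvPolynomial (Fin 2) ℝ :=
  ∑ i, MvPolynomial.monomial (motzkinVertex i + motzkinVertex i) 1 -
    ((3 : ℕ) : ℝ) • MvPolynomial.monomial (Finsupp.equivFunOnFinite.symm ![2, 2]) 1

theorem totalDegree_motzkin_le : motzkin.totalDegree ≤ 6 := by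
  refine totalDegree_agiform_le (fun i => ?_) ?_
  · rw [Finsupp.degree_eq_sum]; fin_cases i <;> simp [motzkinVertex]
  · rw [Finsupp.degree_eq_sum]; simp

theorem motzkin_nonneg (y : Fin 2 → ℝ) : 0 ≤ MvPolynomial.eval y motzkin := by
  have h : MvPolynomial.eval y motzkin =
      1 + y 0 ^ 4 * y 1 ^ 2 + y 0 ^ 2 * y 1 ^ 4 - 3 * (y 0 ^ 2 * y 1 ^ 2) := by
    simp [motzkin, motzkinVertex, Fin.sum_univ_succ, MvPolynomial.eval_monomial,
      Finsupp.prod_fintype, MvPolynomial.smul_eval, Fin.prod_univ_succ]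
    ring
  rw [h]
  generalize y 0 = a
  generalize y 1 = b
  by_cases h0 : a ^ 2 + b ^ 2 = 0
  · have ha : a = 0 := by nlinarith [sq_nonneg a, sq_nonneg b]
    simp [ha]
  · have hpos : 0 < a ^ 2 + b ^ 2 := lt_of_le_of_ne (by positivity) (Ne.symm h0)
    refine nonneg_of_mul_nonneg_right (a := a ^ 2 + b ^ 2) ?_ hpos
    calc 0 ≤ b ^ 2 * (1 - a ^ 2) ^ 2 + a ^ 2 * (1 - b ^ 2) ^ 2 +
          a ^ 2 * b ^ 2 * (a ^ 2 + b ^ 2 - 2) ^ 2 := by positivity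
      _ = _ := by ring

theorem locallySeparatedFromSquares_motzkin : LocallySeparatedFromSquares motzkin := by
  refine locallySeparatedFromSquares_of_height (fun α => motzkinHeight (α 0 : ℕ) (α 1 : ℕ))
    (fun γ => 2 * motzkinHeight (γ 0 / 2 : ℕ) (γ 1 / 2 : ℕ)) {γ | ∃ α, γ = α + α}
    (fun α => ⟨α, rfl⟩) (fun α => ?_) (fun α β hne => ?_) (by norm_num) motzkinVertex (V := 4)
    (fun i => ?_) ⟨Finsupp.equivFunOnFinite.symm ![1, 1], ?_⟩ ?_
  · simp only [Finsupp.add_apply, ← two_mul, Nat.mul_div_cancel_left _ two_pos]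
  · rintro ⟨γ, hγ⟩
    have h0 := DFunLike.congr_fun hγ 0
    have h1 := DFunLike.congr_fun hγ 1
    simp only [Finsupp.add_apply] at h0 h1
    simp only [hγ, Finsupp.add_apply, ← two_mul, Nat.mul_div_cancel_left _ two_pos]
    refine motzkinHeight_midpoint_lt (fun h => hne ?_) h0 h1
    ext i
    fin_cases i
    exacts [h.1, h.2]
  · fin_cases i <;> simp [motzkinVertex, motzkinHeight]
  · ext i
    fin_cases i <;> simp
  · simp [motzkinHeight]

/-- The exponents whose doubles are the vertices of the Newton polytope of the Choi-Lam
polynomial. -/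
noncomputable def choiLamVertex : Fin 4 → (Fin 3 →₀ ℕ) := fun i =>
  Finsupp.equivFunOnFinite.symm (![![0, 0, 0], ![1, 1, 0], ![0, 1, 1], ![1, 0, 1]] i)

/-- The Choi-Lam polynomial `1 + x²y² + y²z² + z²x² - 4xyz`. -/
noncomputable def choiLam : MvPolynomial (Fin 3) ℝ :=
  ∑ i, MvPolynomial.monomial (choiLamVertex i + choiLamVertex i) 1 -
    ((4 : ℕ) : ℝ) • MvPolynomial.monomial (Finsupp.equivFunOnFinite.symm ![1, 1, 1]) 1

theorem totalDegree_choiLam_le : choiLam.totalDegree ≤ 4 := by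
  refine totalDegree_agiform_le (fun i => ?_) ?_
  · rw [Finsupp.degree_eq_sum]; fin_cases i <;> simp [choiLamVertex, Fin.sum_univ_succ]
  · rw [Finsupp.degree_eq_sum]; simp [Fin.sum_univ_succ]

theorem choiLam_nonneg (y : Fin 3 → ℝ) : 0 ≤ MvPolynomial.eval y choiLam := by
  have h : MvPolynomial.eval y choiLam = 1 + y 0 ^ 2 * y 1 ^ 2 + y 1 ^ 2 * y 2 ^ 2 +
      y 2 ^ 2 * y 0 ^ 2 - 4 * (y 0 * y 1 * y 2) := by
    simp [choiLam, choiLamVertex, Fin.sum_univ_succ, MvPolynomial.eval_monomial,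
      Finsupp.prod_fintype, MvPolynomial.smul_eval, Fin.prod_univ_succ]
    ring
  rw [h]
  generalize y 0 = a
  generalize y 1 = b
  generalize y 2 = c
  rcases le_total 0 (a * b) with hab | hab
  · calc 0 ≤ (a - b) ^ 2 * c ^ 2 + 2 * (a * b) * (c - 1) ^ 2 + (1 - a * b) ^ 2 := by positivity
      _ = _ := by ring
  · have hab' : 0 ≤ -(a * b) := neg_nonneg.2 hab
    calc 0 ≤ (a + b) ^ 2 * c ^ 2 + 2 * (-(a * b)) * (c + 1) ^ 2 + (1 + a * b) ^ 2 := by positivity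
      _ = _ := by ring

theorem locallySeparatedFromSquares_choiLam : LocallySeparatedFromSquares choiLam := by
  refine locallySeparatedFromSquares_of_height
    (fun α => choiLamHeight (α 0 : ℕ) (α 1 : ℕ) (α 2 : ℕ))
    (fun γ => if γ 0 % 2 = 1 then 3 else
      2 * choiLamHeight (γ 0 / 2 : ℕ) (γ 1 / 2 : ℕ) (γ 2 / 2 : ℕ))
    ({γ | ∃ α, γ = α + α} ∪ {Finsupp.equivFunOnFinite.symm ![1, 1, 1]})
    (fun α => Or.inl ⟨α, rfl⟩) (fun α => ?_) (fun α β hne => ?_) (by norm_num) choiLamVertex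
    (V := 1) (fun i => ?_) (Or.inr rfl) ?_
  · simp only [Finsupp.add_apply, ← two_mul, Nat.mul_div_cancel_left _ two_pos,
      Nat.mul_mod_right, zero_ne_one, if_false]
  · rintro (⟨γ, hγ⟩ | hγ)
    · have h0 := DFunLike.congr_fun hγ 0
      have h1 := DFunLike.congr_fun hγ 1
      have h2 := DFunLike.congr_fun hγ 2
      simp only [Finsupp.add_apply] at h0 h1 h2
      simp only [hγ, Finsupp.add_apply, ← two_mul, Nat.mul_div_cancel_left _ two_pos,
        Nat.mul_mod_right, zero_ne_one, if_false]
      refine choiLamHeight_midpoint_lt (fun h => hne ?_) h0 h1 h2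
      ext i
      fin_cases i
      exacts [h.1, h.2.1, h.2.2]
    · have h0 := DFunLike.congr_fun hγ 0
      have h1 := DFunLike.congr_fun hγ 1
      have h2 := DFunLike.congr_fun hγ 2
      have hs : (α + β) 0 % 2 = 1 := by rw [h0]; rfl
      simp only [if_pos hs]
      exact choiLamHeight_add_gt h0 h1 h2
  · fin_cases i <;> simp [choiLamVertex, choiLamHeight]
  · simp

theorem closure_convexHull_veronese_not_spectrahedralShadow
    (n d : ℕ) (hnd : (3 ≤ n ∧ 4 ≤ d) ∨ (n = 2 ∧ 6 ≤ d))
    (N : ℕ) (hN : N = (n + d).choose n - 1)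
    (mono : Fin N → (Fin n →₀ ℕ)) (hinj : Function.Injective mono)
    (hrange : Set.range mono = {α : Fin n →₀ ℕ | α ≠ 0 ∧ ∑ i, α i ≤ d})
    (v : (Fin n → ℝ) → (Fin N → ℝ)) (hv : v = fun ξ j => ∏ i, ξ i ^ mono j i)
    (S : Set (Fin n → ℝ)) (hS : IsSemialgebraic S) (hint : (interior S).Nonempty) :
    ¬ IsSpectrahedralShadow (closure (convexHull ℝ (v '' S))) := by
  subst hv
  rcases hnd with ⟨hn, hd⟩ | ⟨rfl, hd⟩
  · exact not_isSpectrahedralShadow_of_locallySeparated (Fin.castLE_injective hn)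
      (totalDegree_choiLam_le.trans hd) choiLam_nonneg locallySeparatedFromSquares_choiLam
      hinj hrange hint
  · exact not_isSpectrahedralShadow_of_locallySeparated Function.injective_id
      (totalDegree_motzkin_le.trans hd) motzkin_nonneg locallySeparatedFromSquares_motzkin
      hinj hrange hint
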